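/- Let c_0 ∈ ℂ be a root of the Gleason polynomial G_{2,n} for some n ≥ 3, and set K = ℚ(c_0). Suppose α ∈ K satisfies v_𝔭(α) = 1 for some prime ideal 𝔭 ⊂ O_K lying above 2. Then there exists N ≥ 1 such that the Galois group of the splitting field of f_{2,c_0}^N − α over K is non-abelian; equivalently, the arboreal Galois group G_∞(f_{2,c_0}, α) = lim← Gal(f_{2,c_0}^N − α / K) is non-abelian. -/

import Mathlib

open Polynomial IntermediateField

noncomputable section

/-- The value sequence `a_i(c)`: `a_0 = 0`, `a_{i+1} = a_i ^ d + c`. -/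
def aSeq (d : ℕ) {F : Type*} [CommRing F] (c : F) : ℕ → F
  | 0 => 0
  | i + 1 => aSeq d c i ^ d + c

/-- The polynomials `a_i ∈ ℤ[c]`: `a_0 = 0`, `a_{i+1} = a_i ^ d + c`. -/
def aPoly (d : ℕ) : ℕ → Polynomial ℤ
  | 0 => 0
  | i + 1 => aPoly d i ^ d + X

/-- Iterates of `f_{d,c} = x^d + c`: `f^0 = x`, `f^{k+1} = f ∘ f^k`. -/
def fIter (d : ℕ) {F : Type*} [CommRing F] (c : F) : ℕ → Polynomial F
  | 0 => X
  | k + 1 => fIter d c k ^ d + C c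

/-- `c₀` is a root of the Gleason polynomial `G_{d,n} = ∏_{k ∣ n} a_k^{μ(n/k)}`. -/
def isGleasonRoot (d n : ℕ) (c₀ : ℂ) : Prop :=
  ∃ g : Polynomial ℤ,
    g * ∏ k ∈ n.divisors, aPoly d k ^ ((-(ArithmeticFunction.moebius (n / k))).toNat)
        = ∏ k ∈ n.divisors, aPoly d k ^ ((ArithmeticFunction.moebius (n / k)).toNat)
    ∧ Polynomial.aeval c₀ g = 0

/-- `c₀` is a root of the Misiurewicz polynomial `G_{d,m,n}^ζ`. -/
def isMisiurewiczRoot (d m n : ℕ) (ζ c₀ : ℂ) : Prop :=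
  ∃ g : Polynomial ℂ,
    g * ((∏ k ∈ n.divisors,
            ((aPoly d (m + k - 1)).map (Int.castRingHom ℂ) -
              C ζ * (aPoly d (m - 1)).map (Int.castRingHom ℂ))
                ^ ((-(ArithmeticFunction.moebius (n / k))).toNat)) *
          (if n ∣ (m - 1) then
            ∏ k ∈ n.divisors, ((aPoly d k).map (Int.castRingHom ℂ))
                ^ ((ArithmeticFunction.moebius (n / k)).toNat)
          else 1))
        = (∏ k ∈ n.divisors,
            ((aPoly d (m + k - 1)).map (Int.castRingHom ℂ) -
              C ζ * (aPoly d (m - 1)).map (Int.castRingHom ℂ))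
                ^ ((ArithmeticFunction.moebius (n / k)).toNat)) *
          (if n ∣ (m - 1) then
            ∏ k ∈ n.divisors, ((aPoly d k).map (Int.castRingHom ℂ))
                ^ ((-(ArithmeticFunction.moebius (n / k))).toNat)
          else 1)
    ∧ g.eval c₀ = 0

/-- The polynomial `F_{k,i}^{(d,c₀)} = ∏_{j=1}^{d-1} (f_{d,c₀}^k - ζ^j a_i(c₀))` over `ℂ`. -/
def FPoly (d : ℕ) (c₀ ζ : ℂ) (k i : ℕ) : Polynomial ℂ :=
  ∏ j ∈ Finset.Icc 1 (d - 1), (fIter d c₀ k - C (ζ ^ j * aSeq d c₀ i))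

/-- In an abelian Galois group, the norm from `K(s)` of a square root `u` of an element
`A - s ∈ K(s)` is fixed by everything that fixes `s`. This obstructs the square classes of
`d = s ^ 2` and `e = A ^ 2 - d` from being independent. -/
theorem exists_not_commute_of_sq_eq {K L : Type*} [Field K] [Field L] [Algebra K L]
    [FiniteDimensional K L] [IsGalois K L] (h2 : (2 : L) ≠ 0) (A d e : K) (s u : L)
    (hs : s ^ 2 = algebraMap K L d) (hu : u ^ 2 = algebraMap K L A - s) (he : A ^ 2 - d = e)
    (hd : ¬ IsSquare d) (hne : ¬ IsSquare e) (hde : ¬ IsSquare (d * e)) :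
    ∃ σ τ : L ≃ₐ[K] L, σ * τ ≠ τ * σ := by
  by_contra! comm
  have moves : ∀ (x : L) (k : K), x ^ 2 = algebraMap K L k → ¬ IsSquare k →
      ∃ τ : L ≃ₐ[K] L, τ x = -x := by
    intro x k hx hk
    by_contra! h
    have hfix : ∀ τ : L ≃ₐ[K] L, τ x = x := fun τ => by
      have : (τ x) ^ 2 = x ^ 2 := by rw [← map_pow, hx, τ.commutes]
      exact (sq_eq_sq_iff_eq_or_eq_neg.mp this).resolve_right (h τ)
    obtain ⟨y, hy⟩ := IntermediateField.mem_bot.mp ((IsGalois.mem_bot_iff_fixed x).mpr hfix)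
    refine hk ⟨y, (algebraMap K L).injective ?_⟩
    rw [← hx, ← hy, map_mul, sq]
  have signs : ∀ (x : L) (k : K), x ^ 2 = algebraMap K L k → ∀ σ : L ≃ₐ[K] L,
      σ x = x ∨ σ x = -x := by
    intro x k hx σ
    exact sq_eq_sq_iff_eq_or_eq_neg.mp (by rw [← map_pow, hx, σ.commutes])
  obtain ⟨τ, hτ⟩ := moves s d hs hd
  obtain ⟨P, hP⟩ : ∃ P, P = u * τ u := ⟨_, rfl⟩
  have hτu : (τ u) ^ 2 = algebraMap K L A + s := by
    rw [← map_pow, hu, map_sub, hτ, τ.commutes, sub_neg_eq_add]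
  have hP2 : P ^ 2 = algebraMap K L e := by
    rw [hP, mul_pow, hu, hτu, ← he, map_sub, map_pow, ← hs]; ring
  have hP0 : P ≠ 0 := by
    rintro h
    rw [h, zero_pow two_ne_zero, eq_comm, map_eq_zero] at hP2
    exact hne ⟨0, by simp [hP2]⟩
  obtain ⟨σ, hσs, hσP⟩ : ∃ σ : L ≃ₐ[K] L, σ s = s ∧ σ P = -P := by
    obtain ⟨σ₁, h₁⟩ := moves P e hP2 hne
    rcases signs s d hs σ₁ with h | h
    · exact ⟨σ₁, h, h₁⟩
    obtain ⟨σ₂, h₂⟩ := moves (s * P) (d * e) (by rw [mul_pow, hs, hP2, map_mul]) hde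
    have hs0 : s ≠ 0 := by
      rintro rfl
      rw [zero_pow two_ne_zero, eq_comm, map_eq_zero] at hs
      exact hd ⟨0, by simp [hs]⟩
    have hsP : s * P ≠ -(s * P) := fun h' => by
      have : 2 * (s * P) = 0 := by linear_combination h'
      exact mul_ne_zero h2 (mul_ne_zero hs0 hP0) this
    rw [map_mul] at h₂
    rcases signs s d hs σ₂ with h' | h' <;> rcases signs P e hP2 σ₂ with h'' | h''
    · exact absurd (by rw [← h₂, h', h'']) hsP
    · exact ⟨σ₂, h', h''⟩
    · exact ⟨σ₁ * σ₂, by simp [h', h], by simp [h'', h₁]⟩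
    · exact absurd (by rw [← h₂, h', h'']; ring) hsP
  have hστ : σ (τ u) = τ (σ u) := DFunLike.congr_fun (comm σ τ) u
  have hfix : σ P = P := by
    have : (σ u) ^ 2 = u ^ 2 := by rw [← map_pow, hu, map_sub, hσs, σ.commutes]
    rcases sq_eq_sq_iff_eq_or_eq_neg.mp this with h | h <;> simp [hP, hστ, h]
  have : 2 * P = 0 := by linear_combination hσP - hfix
  exact mul_ne_zero h2 hP0 this

theorem aSeq_map (d : ℕ) {F E : Type*} [CommRing F] [CommRing E] (φ : F →+* E) (c : F) (k : ℕ) :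
    φ (aSeq d c k) = aSeq d (φ c) k := by
  induction k with
  | zero => simp [aSeq]
  | succ k ih => simp [aSeq, ih]

theorem fIter_map (d : ℕ) {F E : Type*} [CommRing F] [CommRing E] (φ : F →+* E) (c : F) (k : ℕ) :
    (fIter d c k).map φ = fIter d (φ c) k := by
  induction k with
  | zero => simp [fIter]
  | succ k ih => simp [fIter, ih]

theorem aeval_aPoly (d : ℕ) {F : Type*} [CommRing F] (c : F) (k : ℕ) :
    aeval c (aPoly d k) = aSeq d c k := by
  induction k with
  | zero => simp [aSeq, aPoly]
  | succ k ih => simp [aSeq, aPoly, ih]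

theorem aSeq_add_of_eq_zero (d : ℕ) {F : Type*} [CommRing F] {c : F} {k : ℕ}
    (h : aSeq d c k = 0) (j : ℕ) : aSeq d c (k + j) = aSeq d c j := by
  induction j with
  | zero => simpa [aSeq] using h
  | succ j ih => rw [← add_assoc, aSeq, aSeq, ih]

theorem natDegree_fIter {F : Type*} [Field F] (c : F) (k : ℕ) :
    (fIter 2 c k).natDegree = 2 ^ k := by
  induction k with
  | zero => simp [fIter]
  | succ k ih => rw [fIter, natDegree_add_C, natDegree_pow, ih, pow_succ']

theorem fIter_sub_C_ne_zero {F : Type*} [Field F] (c t : F) (k : ℕ) :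
    fIter 2 c k - C t ≠ 0 := by
  intro h
  have h' := natDegree_sub_C (p := fIter 2 c k) (a := t)
  rw [h, natDegree_fIter, natDegree_zero] at h'
  exact absurd h' (by positivity)

theorem exists_sq_eq_of_splits_fIter {F : Type*} [Field F] {c t : F} {k : ℕ}
    (h : (fIter 2 c (k + 1) - C t).Splits) :
    ∃ r : F, r ^ 2 = t - c ∧ (fIter 2 c k - C r).Splits ∧ (fIter 2 c k - C (-r)).Splits := by
  obtain ⟨β, hβ⟩ := h.exists_eval_eq_zero (by
    apply degree_ne_of_natDegree_ne
    rw [natDegree_sub_C, natDegree_fIter]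
    positivity)
  have hr : (eval β (fIter 2 c k)) ^ 2 = t - c := by
    simp only [fIter, eval_sub, eval_add, eval_pow, eval_C] at hβ
    linear_combination hβ
  refine ⟨_, hr, (splits_mul (fIter_sub_C_ne_zero _ _ _) (fIter_sub_C_ne_zero _ _ _)).mp ?_⟩
  convert h using 1
  have hC := congrArg C hr
  simp only [C_sub, C_pow] at hC
  rw [fIter, C_neg]
  linear_combination -hC

theorem isSquare_aSeq_sub_of_splits {F : Type*} [Field F] {c : F} (k : ℕ) :
    ∀ {t : F}, (fIter 2 c (k + 2) - C t).Splits → ∃ u : F, u ^ 2 = aSeq 2 c (k + 2) - t := by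
  induction k with
  | zero =>
    intro t h
    obtain ⟨r, hr, h₁, h₂⟩ := exists_sq_eq_of_splits_fIter h
    obtain ⟨p, hp, -⟩ := exists_sq_eq_of_splits_fIter h₁
    obtain ⟨q, hq, -⟩ := exists_sq_eq_of_splits_fIter h₂
    refine ⟨p * q, ?_⟩
    simp only [aSeq]
    rw [mul_pow, hp, hq]
    linear_combination -hr
  | succ k ih =>
    intro t h
    obtain ⟨r, hr, h₁, h₂⟩ := exists_sq_eq_of_splits_fIter h
    obtain ⟨p, hp⟩ := ih h₁
    obtain ⟨q, hq⟩ := ih h₂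
    refine ⟨p * q, ?_⟩
    rw [mul_pow, hp, hq, show k + 1 + 2 = (k + 2) + 1 from rfl, aSeq.eq_2 2 c (k + 2)]
    linear_combination -hr

section Valuation

variable {K Γ : Type*} [Field K] [LinearOrderedCommGroupWithZero Γ] (v : Valuation K Γ)

theorem valuation_eq_one_of_aSeq_eq_zero {c : K} (hc : c ≠ 0) {N : ℕ}
    (h : aSeq 2 c (N + 1) = 0) : v c = 1 := by
  have hv0 : 0 < v c := zero_lt_iff.mpr ((Valuation.ne_zero_iff v).mpr hc)
  rcases lt_trichotomy (v c) 1 with hlt | heq | hgt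
  · have : ∀ k, v (aSeq 2 c (k + 1)) = v c := by
      intro k
      induction k with
      | zero => simp [aSeq]
      | succ k ih =>
        rw [aSeq]
        apply Valuation.map_add_eq_of_lt_right
        rw [map_pow, ih, sq]
        exact mul_lt_of_lt_one_right hv0 hlt
    have := this N
    rw [h, map_zero] at this
    exact absurd this hv0.ne
  · exact heq
  · have : ∀ k, v c ≤ v (aSeq 2 c (k + 1)) := by
      intro k
      induction k with
      | zero => simp [aSeq]
      | succ k ih =>
        have hlt : v c < v (aSeq 2 c (k + 1) ^ 2) := by
          rw [map_pow, sq]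
          exact lt_of_lt_of_le (lt_mul_of_one_lt_right hv0 hgt) (mul_le_mul' ih ih)
        rw [aSeq, Valuation.map_add_eq_of_lt_left _ hlt]
        exact hlt.le
    have := this N
    rw [h, map_zero] at this
    exact absurd this hv0.not_ge

theorem sq_ne_of_isGreatest_lt_one {w : Γ} (hw0 : 0 < w) (hw1 : w < 1)
    (hw : ∀ x < 1, x ≤ w) (γ : Γ) : γ ^ 2 ≠ w := by
  intro h
  rcases lt_or_ge γ 1 with h1 | h1
  · have : γ * γ ≤ w * w := mul_le_mul' (hw _ h1) (hw _ h1)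
    rw [← sq, h] at this
    exact absurd this (mul_lt_of_lt_one_right hw0 hw1).not_ge
  · exact absurd (h ▸ one_le_pow₀ h1 : (1 : Γ) ≤ w) hw1.not_ge

theorem not_isSquare_of_valuation_eq {w : Γ} (hw0 : 0 < w) (hw1 : w < 1)
    (hw : ∀ x < 1, x ≤ w) {x : K} (hx : v x = w) : ¬ IsSquare x := by
  rintro ⟨y, rfl⟩
  exact sq_ne_of_isGreatest_lt_one hw0 hw1 hw (v y) (by rw [← hx, map_mul, sq])

theorem not_isSquare_add_sq_of_valuation_eq {w : Γ} (hw0 : 0 < w) (hw1 : w < 1)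
    (hw : ∀ x < 1, x ≤ w) (h2 : v 2 < 1) {a α : K} (ha : v a = 1)
    (hα : v α = w) : ¬ IsSquare (α + a ^ 2) := by
  rintro ⟨s, hs⟩
  have hprod : v (s - a) * v (s + a) = w := by
    rw [← map_mul, ← hα]
    congr 1
    linear_combination -hs
  have h2a : v (2 * a) < 1 := by rw [map_mul, ha, mul_one]; exact h2
  have hsum : s + a = (s - a) + 2 * a := by ring
  rcases lt_or_ge (v (s - a)) 1 with h1 | h1
  · have h3 : v (s + a) < 1 := by
      rw [hsum]
      exact Valuation.map_add_lt _ h1 h2a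
    have := mul_le_mul' (hw _ h1) (hw _ h3)
    rw [hprod] at this
    exact absurd this (mul_lt_of_lt_one_right hw0 hw1).not_ge
  · have h3 : v (s + a) = v (s - a) := by
      rw [hsum]
      exact Valuation.map_add_eq_of_lt_left _ (h2a.trans_le h1)
    rw [h3] at hprod
    exact absurd (hprod ▸ one_le_mul h1 h1 : (1 : Γ) ≤ w) hw1.not_ge

end Valuation

theorem exists_aPoly_eq_X_mul (k : ℕ) :
    ∃ r : ℤ[X], aPoly 2 (k + 1) = X * r ∧ r.eval 0 = 1 := by
  induction k with
  | zero => exact ⟨1, by simp [aPoly]⟩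
  | succ k ih =>
    obtain ⟨r, hr, h0⟩ := ih
    exact ⟨X * r ^ 2 + 1, by rw [aPoly, hr]; ring, by simp⟩

theorem aPoly_succ_ne_zero (k : ℕ) : aPoly 2 (k + 1) ≠ 0 := by
  obtain ⟨r, hr, h0⟩ := exists_aPoly_eq_X_mul k
  rw [hr]
  refine mul_ne_zero X_ne_zero ?_
  rintro rfl
  simp at h0

theorem sum_divisors_moebius_eq_zero {n : ℕ} (hn : 2 ≤ n) :
    ∑ k ∈ n.divisors, ArithmeticFunction.moebius (n / k) = 0 := by
  rw [Nat.sum_div_divisors n (fun k => ArithmeticFunction.moebius k),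
    ← ArithmeticFunction.coe_mul_zeta_apply, ArithmeticFunction.moebius_mul_coe_zeta,
    ArithmeticFunction.one_apply_ne (by omega)]

theorem isGleasonRoot.ne_zero {n : ℕ} (hn : 2 ≤ n) {c₀ : ℂ} (h : isGleasonRoot 2 n c₀) :
    c₀ ≠ 0 := by
  rintro rfl
  obtain ⟨g, hg, hg0⟩ := h
  choose r hr hr0 using exists_aPoly_eq_X_mul
  have factor : ∀ m : ℕ → ℕ, ∏ k ∈ n.divisors, aPoly 2 k ^ m k =
      X ^ (∑ k ∈ n.divisors, m k) * ∏ k ∈ n.divisors, r (k - 1) ^ m k := by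
    intro m
    rw [← Finset.prod_pow_eq_pow_sum, ← Finset.prod_mul_distrib]
    refine Finset.prod_congr rfl fun k hk => ?_
    have hk : k = k - 1 + 1 := (Nat.sub_add_cancel (Nat.pos_of_mem_divisors hk)).symm
    rw [← mul_pow, ← hr, ← hk]
  have hsum : ∑ k ∈ n.divisors, (-(ArithmeticFunction.moebius (n / k))).toNat =
      ∑ k ∈ n.divisors, (ArithmeticFunction.moebius (n / k)).toNat := by
    zify
    rw [← sub_eq_zero, ← Finset.sum_sub_distrib, ← neg_eq_zero, ← Finset.sum_neg_distrib,
      ← sum_divisors_moebius_eq_zero hn]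
    exact Finset.sum_congr rfl fun k _ => by omega
  rw [factor, factor, hsum, mul_left_comm] at hg
  have := congrArg (eval 0) (mul_left_cancel₀ (pow_ne_zero _ X_ne_zero) hg)
  simp only [eval_mul, eval_prod, eval_pow, hr0, one_pow, Finset.prod_const_one, mul_one] at this
  rw [← map_zero (Int.castRingHom ℂ), aeval_def, algebraMap_int_eq, eval₂_at_apply, this] at hg0
  simp at hg0

theorem isGleasonRoot.exists_aSeq_eq_zero {n : ℕ} {c₀ : ℂ} (h : isGleasonRoot 2 n c₀) :
    ∃ k : ℕ, aSeq 2 c₀ (k + 1) = 0 := by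
  obtain ⟨g, hg, hg0⟩ := h
  have := congrArg (aeval c₀) hg
  rw [map_mul, hg0, zero_mul, map_prod, eq_comm, Finset.prod_eq_zero_iff] at this
  obtain ⟨k, hk, h0⟩ := this
  rw [map_pow, aeval_aPoly] at h0
  refine ⟨k - 1, ?_⟩
  rw [Nat.sub_add_cancel (Nat.pos_of_mem_divisors hk)]
  exact eq_zero_of_pow_eq_zero h0

theorem aSeq_three_mul_eq_zero {F : Type*} [CommRing F] {c : F} {k : ℕ} (h : aSeq 2 c k = 0) :
    aSeq 2 c (3 * k) = 0 := by
  rw [show 3 * k = k + (k + k) by ring, aSeq_add_of_eq_zero 2 h, aSeq_add_of_eq_zero 2 h, h]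

theorem exists_gal_not_commute {K Γ : Type*} [Field K] [CharZero K]
    [LinearOrderedCommGroupWithZero Γ] (v : Valuation K Γ) {w : Γ} (hw0 : 0 < w) (hw1 : w < 1)
    (hw : ∀ x < 1, x ≤ w) (h2 : v 2 < 1) {c α : K} (hc : c ≠ 0) (hα : v α = w) {m : ℕ}
    (hN : aSeq 2 c (m + 3) = 0) :
    ∃ σ τ : (fIter 2 c (m + 3) - C α).Gal, σ * τ ≠ τ * σ := by
  have hvc : v c = 1 := valuation_eq_one_of_aSeq_eq_zero v hc hN
  let p := fIter 2 c (m + 3) - C α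
  let φ := algebraMap K p.SplittingField
  have hsplit : (fIter 2 (φ c) (m + 3) - C (φ α)).Splits := by
    have := SplittingField.splits p
    rwa [Polynomial.map_sub, fIter_map, Polynomial.map_C] at this
  obtain ⟨s, hs, hs', -⟩ := exists_sq_eq_of_splits_fIter hsplit
  obtain ⟨u, hu⟩ := isSquare_aSeq_sub_of_splits m hs'
  have hA : aSeq 2 c (m + 2) ^ 2 = -c := by
    rw [aSeq] at hN
    linear_combination hN
  have hvA : v (aSeq 2 c (m + 2)) = 1 := by
    have : v (aSeq 2 c (m + 2)) ^ 2 = 1 := by rw [← map_pow, hA, Valuation.map_neg, hvc]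
    exact (pow_eq_one_iff_of_nonneg zero_le two_ne_zero).mp this
  have hvd : v (α - c) = 1 := by
    rw [sub_eq_add_neg, Valuation.map_add_eq_of_lt_right, Valuation.map_neg, hvc]
    rwa [Valuation.map_neg, hvc, hα]
  have : IsGalois K p.SplittingField := {}
  refine exists_not_commute_of_sq_eq (L := p.SplittingField) ?_
    (aSeq 2 c (m + 2)) (α - c) (-α) s u ?_ ?_ ?_ ?_ ?_ ?_
  · have := (algebraMap K p.SplittingField).injective.ne (two_ne_zero (α := K))
    simpa only [map_ofNat, map_zero] using this
  · rw [hs, map_sub]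
  · rw [hu, aSeq_map]
  · rw [hA]; ring
  · rw [show α - c = α + aSeq 2 c (m + 2) ^ 2 by rw [hA]; ring]
    exact not_isSquare_add_sq_of_valuation_eq v hw0 hw1 hw h2 hvA hα
  · exact not_isSquare_of_valuation_eq v hw0 hw1 hw (by rw [Valuation.map_neg, hα])
  · exact not_isSquare_of_valuation_eq v hw0 hw1 hw
      (by rw [map_mul, hvd, Valuation.map_neg, hα, one_mul])

/-- For a Gleason parameter `c₀` of period `n ≥ 3` for `d = 2`,
`K = ℚ(c₀)`, and `α ∈ K` with `v_𝔭(α) = 1` at some prime `𝔭` of `O_K` above `2`, some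
iterated Galois group `Gal(f_{2,c₀}^N - α / K)` is non-abelian (equivalently, the arboreal
Galois group `G_∞(f_{2,c₀}, α)` is non-abelian). -/
theorem stmt4 (n : ℕ) (hn : 3 ≤ n)
    (c₀ : ℂ) (hc₀ : isGleasonRoot 2 n c₀)
    (α : ℚ⟮c₀⟯)
    (𝔭 : Ideal (integralClosure ℤ ℚ⟮c₀⟯)) (h𝔭 : 𝔭.IsPrime)
    (h𝔭2 : (2 : integralClosure ℤ ℚ⟮c₀⟯) ∈ 𝔭)
    (hα : ∃ a b : integralClosure ℤ ℚ⟮c₀⟯, b ∉ 𝔭 ∧ α * b = a ∧ a ∈ 𝔭 ∧ a ∉ 𝔭 ^ 2) :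
    ∃ N : ℕ, 1 ≤ N ∧
      ∃ σ τ : (fIter 2 (IntermediateField.AdjoinSimple.gen ℚ c₀) N - C α).Gal,
        σ * τ ≠ τ * σ := by
  obtain ⟨k, hk⟩ := hc₀.exists_aSeq_eq_zero
  have halg : IsAlgebraic ℤ c₀ := ⟨_, aPoly_succ_ne_zero k, by rw [aeval_aPoly, hk]⟩
  have hint : IsIntegral ℚ c₀ := (halg.extendScalars (Int.cast_injective)).isIntegral
  have := IntermediateField.adjoin.finiteDimensional hint
  have : IsDedekindDomain (integralClosure ℤ ℚ⟮c₀⟯) := integralClosure.isDedekindDomain ℤ ℚ ℚ⟮c₀⟯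
  have : IsFractionRing (integralClosure ℤ ℚ⟮c₀⟯) ℚ⟮c₀⟯ :=
    integralClosure.isFractionRing_of_finite_extension ℚ ℚ⟮c₀⟯
  have hbot : 𝔭 ≠ ⊥ := by
    rintro rfl
    exact two_ne_zero (Ideal.mem_bot.mp h𝔭2)
  let P : IsDedekindDomain.HeightOneSpectrum (integralClosure ℤ ℚ⟮c₀⟯) := ⟨𝔭, h𝔭, hbot⟩
  have hgen : algebraMap ℚ⟮c₀⟯ ℂ (AdjoinSimple.gen ℚ c₀) = c₀ := AdjoinSimple.algebraMap_gen ℚ c₀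
  have hc : AdjoinSimple.gen ℚ c₀ ≠ 0 := by
    intro h
    rw [h, map_zero] at hgen
    exact hc₀.ne_zero (by omega) hgen.symm
  have hzero : aSeq 2 (AdjoinSimple.gen ℚ c₀) (k + 1) = 0 := by
    apply (algebraMap ℚ⟮c₀⟯ ℂ).injective
    rw [aSeq_map, hgen, hk, map_zero]
  have hw : ∀ x : WithZero (Multiplicative ℤ), x < 1 → x ≤ WithZero.exp (-1 : ℤ) := by
    intro x hx
    rcases eq_or_ne x 0 with rfl | h0
    · exact zero_le
    · rw [← WithZero.log_le_iff_le_exp h0]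
      rw [← WithZero.exp_zero, ← WithZero.log_lt_iff_lt_exp h0] at hx
      omega
  have h2 : P.valuation ℚ⟮c₀⟯ 2 < 1 := by
    have := (P.valuation_lt_one_iff_mem (K := ℚ⟮c₀⟯) 2).mpr h𝔭2
    exact this
  have hvα : P.valuation ℚ⟮c₀⟯ α = WithZero.exp (-1 : ℤ) := by
    obtain ⟨a, b, hb, hab, ha, ha2⟩ := hα
    have hvb : P.valuation ℚ⟮c₀⟯ (algebraMap _ _ b) = 1 := P.valuation_eq_one_iff_notMem.mpr hb
    have hva : P.valuation ℚ⟮c₀⟯ α = P.intValuation a := by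
      change α * algebraMap _ ℚ⟮c₀⟯ b = algebraMap _ _ a at hab
      have := congrArg (P.valuation ℚ⟮c₀⟯) hab
      rw [map_mul, hvb, mul_one] at this
      exact this.trans (P.valuation_of_algebraMap a)
    rw [hva]
    refine le_antisymm (hw _ ((P.intValuation_lt_one_iff_mem a).mpr ha)) ?_
    by_contra! hlt
    refine ha2 ((P.intValuation_le_pow_iff_mem a 2).mp ?_)
    have h0 : P.intValuation a ≠ 0 := P.intValuation_ne_zero a (by rintro rfl; simp at ha2)
    rw [← WithZero.log_le_iff_le_exp h0]
    rw [← WithZero.log_lt_iff_lt_exp h0] at hlt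
    push_cast
    omega
  refine ⟨3 * k + 3, by omega, exists_gal_not_commute (P.valuation ℚ⟮c₀⟯)
    WithZero.exp_pos ?_ hw h2 hc hvα (aSeq_three_mul_eq_zero hzero)⟩
  rw [← WithZero.exp_zero, WithZero.exp_lt_exp]
  norm_num
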